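/- The element δ = t·x'/x of L^× (i.e. dlog(x)/dlog(t)) is a refined logarithmic different of L over K: δ·k[[t]] = m_K^{−1}·m_L·D_{k[[t]]/A} as fractional ideals of L, and for every a ∈ k[[t]], Tr_{L/K}(δ^{−1}·a) ∈ A and Tr_{L/K}(δ^{−1}·a) − φ(a(0)) ∈ m_K, where a(0) ∈ k is the constant coefficient of a, regarded as a constant Laurent series in k((X)). -/

import Mathlib

noncomputable section

open IsLocalRing FractionalIdeal

namespace LFT

variable {F : Type*} [Field F]

/-- The formal derivative of a Laurent series: the coefficient of `t^j` in `lsDeriv x`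
is `(j+1)` times the coefficient of `t^{j+1}` in `x`. -/
def lsDeriv (x : LaurentSeries F) : LaurentSeries F where
  coeff j := (j + 1) • x.coeff (j + 1)
  isPWO_support' := by
    have h : Function.support (fun j : ℤ => (j + 1) • x.coeff (j + 1)) ⊆
        (fun j : ℤ => j - 1) '' Function.support x.coeff := by
      intro j hj
      refine ⟨j + 1, ?_, by ring⟩
      intro h0
      simp [Function.mem_support, h0] at hj
    exact (x.isPWO_support'.image_of_monotone (fun a b hab => by omega)).mono h

/-- The uniformizer `t` of `F((t))`. -/
def tt : LaurentSeries F := HahnSeries.single 1 1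

/-- `ordGe x N` means `ord x ≥ N`, with the convention `ord 0 = +∞`. -/
def ordGe (x : LaurentSeries F) (N : ℤ) : Prop := x = 0 ∨ N ≤ x.order

/-- The valuation subring `k[[t]]` of `L = k((t))`. -/
def psRange (k : Type*) [Field k] : Subring (LaurentSeries k) :=
  (HahnSeries.ofPowerSeries ℤ k).range

section Helpers

open PowerSeries

theorem aux_descent {k : Type*} [Field k] (x0 : k⟦X⟧) (hx0 : X ∣ x0) (z : ℕ → k⟦X⟧)
    (h : ∀ q, z q = x0 * z (q + 1)) : ∀ q, z q = 0 := by
  intro q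
  have key : ∀ N q, (X : k⟦X⟧) ^ N ∣ z q := by
    intro N
    induction N with
    | zero => intro q; simp
    | succ N ih =>
      intro q
      rw [h q, pow_succ']
      exact mul_dvd_mul hx0 (ih _)
  ext m
  have := X_pow_dvd_iff.mp (key (m + 1) q) m (by omega)
  simpa using this

/-- common decomposition -/
theorem aux_psi_split {k : Type*} [Field k] (ψ : k⟦X⟧ →+* k⟦X⟧) (hC : ∀ a : k, ψ (C a) = C a)
    (g : k⟦X⟧) :
    ψ g = C (constantCoeff g) + ψ X * ψ (mk fun q => coeff (q + 1) g) := by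
  conv_lhs => rw [eq_X_mul_shift_add_const g]
  rw [map_add, map_mul, hC, add_comm]

theorem aux_exists {k : Type*} [Field k] (ψ : k⟦X⟧ →+* k⟦X⟧) (hC : ∀ a : k, ψ (C a) = C a)
    (n : ℕ) (hn : 1 ≤ n) (u u' : k⟦X⟧) (hu : u * u' = 1) (hX : ψ X = X ^ n * u) (y : k⟦X⟧) :
    ∃ g : ℕ → k⟦X⟧, y = ∑ i ∈ Finset.range n, ψ (g i) * X ^ i := by
  let step : k⟦X⟧ → k⟦X⟧ := fun y => u' * mk fun i => coeff (i + n) y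
  have hstep : ∀ y, y = ∑ i ∈ Finset.range n, C (coeff i y) * X ^ i + ψ X * step y := by
    intro y
    have e1 : ψ X * step y = X ^ n * mk fun i => coeff (i + n) y := by
      simp only [step]; rw [hX]; linear_combination (X ^ n * mk fun i => coeff (i + n) y) * hu
    rw [e1]
    ext m
    simp only [map_add, map_sum, coeff_C_mul, coeff_X_pow, coeff_X_pow_mul']
    by_cases hm : m < n
    · rw [if_neg (by omega), Finset.sum_eq_single m] <;> simp +contextual [hm, eq_comm]
    · rw [if_pos (by omega), Finset.sum_eq_zero]
      · simp [Nat.sub_add_cancel (not_lt.mp hm)]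
      · intro i hi
        have := Finset.mem_range.mp hi
        rw [if_neg (by omega)]; simp
  let Y : ℕ → k⟦X⟧ := fun q => step^[q] y
  let G : ℕ → ℕ → k⟦X⟧ := fun Q i => mk fun q => coeff i (Y (q + Q))
  have hG : ∀ Q i, ψ (G Q i) = C (coeff i (Y Q)) + ψ X * ψ (G (Q + 1) i) := by
    intro Q i
    rw [aux_psi_split ψ hC]
    simp [G, add_assoc, add_comm 1]
  have h0 := aux_descent (ψ X) (by rw [hX]; exact (dvd_pow_self _ (by omega)).mul_right _)
    (fun Q => Y Q - ∑ i ∈ Finset.range n, ψ (G Q i) * X ^ i) (by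
      intro Q
      have hY : Y (Q + 1) = step (Y Q) := Function.iterate_succ_apply' _ _ _
      simp only [hY, hG Q]
      simp only [add_mul, Finset.sum_add_distrib, mul_sub, Finset.mul_sum, mul_assoc]
      linear_combination hstep (Y Q)) 0
  exact ⟨G 0, sub_eq_zero.mp h0⟩

theorem aux_coeff {k : Type*} [Field k] (ψ : k⟦X⟧ →+* k⟦X⟧) (hC : ∀ a : k, ψ (C a) = C a)
    (n : ℕ) (u : k⟦X⟧) (hX : ψ X = X ^ n * u) (g : ℕ → k⟦X⟧)
    (j : ℕ) (hj : j < n) :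
    coeff j (∑ i ∈ Finset.range n, ψ (g i) * X ^ i) = constantCoeff (g j) := by
  have : ∀ i ∈ Finset.range n, coeff j (ψ (g i) * X ^ i)
      = if j = i then constantCoeff (g j) else 0 := by
    intro i hi
    rw [aux_psi_split ψ hC, hX, add_mul, map_add, mul_assoc, mul_assoc, coeff_X_pow_mul',
      if_neg (by omega), coeff_C_mul, coeff_X_pow]
    split_ifs with hji
    · simp [hji]
    · simp
  rw [map_sum, Finset.sum_congr rfl this]
  simp [hj]

theorem aux_indep {k : Type*} [Field k] (ψ : k⟦X⟧ →+* k⟦X⟧) (hC : ∀ a : k, ψ (C a) = C a)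
    (n : ℕ) (u : k⟦X⟧) (hX : ψ X = X ^ n * u) (hX0 : ψ X ≠ 0) (g : ℕ → k⟦X⟧)
    (h : ∑ i ∈ Finset.range n, ψ (g i) * X ^ i = 0)
    (j : ℕ) (hj : j < n) : g j = 0 := by
  let G : ℕ → ℕ → k⟦X⟧ := fun Q i => mk fun q => coeff (q + Q) (g i)
  have key : ∀ Q, ∑ i ∈ Finset.range n, ψ (G Q i) * X ^ i = 0 := by
    intro Q
    induction Q with
    | zero =>
      have : G 0 = g := by funext i; ext q; simp [G]
      rwa [this]
    | succ Q ih =>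
      have h0 : ∀ i < n, constantCoeff (G Q i) = 0 := by
        intro i hi
        rw [← aux_coeff ψ hC n u hX (G Q) i hi, ih, map_zero]
      have : ∀ i ∈ Finset.range n, ψ (G Q i) * X ^ i = ψ X * (ψ (G (Q+1) i) * X ^ i) := by
        intro i hi
        rw [aux_psi_split ψ hC (G Q i), h0 i (Finset.mem_range.mp hi)]
        simp [G, add_assoc, add_comm 1, mul_assoc]
      rw [Finset.sum_congr rfl this, ← Finset.mul_sum] at ih
      exact (mul_eq_zero.mp ih).resolve_left hX0
  ext Q
  have := aux_coeff ψ hC n u hX (G Q) j hj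
  rw [key] at this
  simpa [G] using this.symm

theorem aux_chain {k : Type*} [Field k] (ψ : k⟦X⟧ →+* k⟦X⟧) (hC : ∀ a : k, ψ (C a) = C a)
    (hX : X ∣ ψ X) (g : k⟦X⟧) :
    derivative k (ψ g) = ψ (derivative k g) * derivative k (ψ X) := by
  let G : ℕ → k⟦X⟧ := fun Q => mk fun q => coeff (q + Q) g
  have hG : ∀ Q, G Q = C (coeff Q g) + X * G (Q + 1) := by
    intro Q
    conv_lhs => rw [eq_X_mul_shift_add_const (G Q)]
    rw [add_comm]
    simp [G, add_assoc, add_comm 1]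
  have := aux_descent (ψ X) hX
    (fun Q => derivative k (ψ (G Q)) - ψ (derivative k (G Q)) * derivative k (ψ X)) (by
      intro Q
      simp only [hG Q]
      simp [hC, Derivation.leibniz]
      ring) 0
  have hg : G 0 = g := by ext q; simp [G]
  simp only [hg] at this
  exact sub_eq_zero.mp this

theorem aux_diff {k : Type*} [Field k] (ψ : k⟦X⟧ →+* k⟦X⟧) (hC : ∀ a : k, ψ (C a) = C a)
    (n : ℕ) (hn : 1 ≤ n) (u : k⟦X⟧) (hX : ψ X = X ^ n * u) (g : ℕ → k⟦X⟧)
    (h : X ^ n = ∑ i ∈ Finset.range n, ψ (g i) * X ^ i) :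
    ∃ v : k⟦X⟧, constantCoeff u * constantCoeff v = 1 ∧
      (n : k⟦X⟧) * X ^ (n - 1) - ∑ i ∈ Finset.range n, ψ (g i) * ((i : k⟦X⟧) * X ^ (i - 1)) =
        derivative k (ψ X) * v := by
  have hX1 : (X : k⟦X⟧) ∣ ψ X := by rw [hX]; exact (dvd_pow_self _ (by omega)).mul_right _
  refine ⟨∑ i ∈ Finset.range n, ψ (derivative k (g i)) * X ^ i, ?_, ?_⟩
  · have h0 : ∀ i < n, constantCoeff (g i) = 0 := by
      intro i hi
      rw [← aux_coeff ψ hC n u hX g i hi, ← h, coeff_X_pow, if_neg (by omega)]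
    have : ∀ i ∈ Finset.range n, ψ (g i) * X ^ i =
        X ^ n * (u * (ψ (mk fun q => coeff (q + 1) (g i)) * X ^ i)) := by
      intro i hi
      rw [aux_psi_split ψ hC (g i), h0 i (Finset.mem_range.mp hi), hX]
      simp [mul_assoc]
    rw [Finset.sum_congr rfl this, ← Finset.mul_sum, ← Finset.mul_sum] at h
    have h1 : u * ∑ i ∈ Finset.range n, ψ (mk fun q => coeff (q + 1) (g i)) * X ^ i = 1 :=
      (mul_left_cancel₀ (pow_ne_zero n X_ne_zero) (by rw [mul_one]; exact h)).symm
    have h2 := congrArg constantCoeff h1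
    rw [map_mul, map_one] at h2
    rw [← h2]
    congr 1
    rw [← coeff_zero_eq_constantCoeff_apply, ← coeff_zero_eq_constantCoeff_apply,
      aux_coeff ψ hC n u hX _ 0 hn, aux_coeff ψ hC n u hX _ 0 hn]
    simp [← coeff_zero_eq_constantCoeff_apply, coeff_derivative]
  · have h3 := congrArg (derivative k) h
    simp only [map_sum, Derivation.leibniz, smul_eq_mul, derivative_pow, derivative_X, mul_one,
      Finset.sum_add_distrib] at h3
    rw [h3, add_sub_cancel_left, Finset.mul_sum]
    refine Finset.sum_congr rfl fun i _ => ?_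
    rw [aux_chain ψ hC hX1]
    ring

open Polynomial in
theorem aux_trace {K L : Type*} [Field K] [Field L] [Algebra K L] (pb : PowerBasis K L)
    (h : aeval pb.gen (derivative (minpoly K pb.gen)) ≠ 0) (i : ℕ) (hi : i < pb.dim) :
    Algebra.trace K L (pb.gen ^ i / aeval pb.gen (derivative (minpoly K pb.gen))) =
      if i + 1 = pb.dim then 1 else 0 := by
  classical
  have : FiniteDimensional K L := pb.finite
  have hint : IsIntegral K pb.gen := pb.isIntegral_gen
  have hsep : IsSeparable K pb.gen := by
    refine (separable_iff_derivative_ne_zero (minpoly.irreducible hint)).mpr ?_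
    intro h0
    exact h (by rw [h0, map_zero])
  have : Algebra.IsSeparable K L := by
    have h1 := (IntermediateField.isSeparable_adjoin_simple_iff_isSeparable K L).mpr hsep
    have h2 : IntermediateField.adjoin K {pb.gen} = ⊤ := by
      rw [← IntermediateField.toSubalgebra_inj, IntermediateField.top_toSubalgebra]
      rw [IntermediateField.adjoin_simple_toSubalgebra_of_isAlgebraic hint.isAlgebraic]
      exact pb.adjoin_gen_eq_top
    rw [h2] at h1
    exact Algebra.IsSeparable.of_algHom K _ (IntermediateField.topEquiv (F := K) (E := L)).symm.toAlgHom
  have hpos : 0 < pb.dim := by omega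
  let j : Fin pb.dim := ⟨pb.dim - 1, by omega⟩
  have hb := Module.Basis.traceDual_powerBasis_eq pb j
  have hcoeff : (minpolyDiv K pb.gen).coeff (j : ℕ) = 1 := by
    have := (minpolyDiv_monic hint).coeff_natDegree
    rwa [natDegree_minpolyDiv, pb.natDegree_minpoly] at this
  rw [hcoeff] at hb
  have := pb.basis.traceDual_eq_iff.mp rfl j ⟨i, hi⟩
  rw [hb, Algebra.traceForm_apply, pb.basis_eq_pow] at this
  simp only [one_div, inv_mul_eq_div] at this
  rw [this]
  simp only [j, Fin.ext_iff]
  split_ifs <;> first | rfl | omega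

theorem aux_eqpow {k : Type*} [Field k] (y : LaurentSeries k) :
    ∃ N : ℕ, ∀ M ≥ N, ∃ b : k⟦X⟧, y * HahnSeries.ofPowerSeries ℤ k X ^ M =
      HahnSeries.ofPowerSeries ℤ k b := by
  refine ⟨(-y.order).toNat, fun M hM => ?_⟩
  refine ⟨X ^ (y.order + M).toNat * y.powerSeriesPart, ?_⟩
  conv_lhs => rw [← y.single_order_mul_powerSeriesPart]
  rw [map_mul, map_pow, HahnSeries.ofPowerSeries_X, HahnSeries.single_pow, HahnSeries.single_pow,
    mul_right_comm, HahnSeries.single_mul_single]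
  congr 3
  · simp; omega
  · simp

set_option maxHeartbeats 1000000 in
theorem aux_field {k : Type*} [Field k] (φ : LaurentSeries k →+* LaurentSeries k)
    (ψ : k⟦X⟧ →+* k⟦X⟧)
    (hψ : ∀ g, φ (HahnSeries.ofPowerSeries ℤ k g) = HahnSeries.ofPowerSeries ℤ k (ψ g))
    (hC : ∀ a : k, ψ (C a) = C a)
    (n : ℕ) (hn : 1 ≤ n) (u u' : k⟦X⟧) (hu : u * u' = 1) (hX : ψ X = X ^ n * u)
    (hd : derivative k (ψ X) ≠ 0) :
    ∃ v : k⟦X⟧, constantCoeff u * constantCoeff v = 1 ∧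
      ∀ b : k⟦X⟧, ∃ g : k⟦X⟧, constantCoeff g = coeff (n - 1) b ∧
        ((Algebra.trace ↥φ.fieldRange (LaurentSeries k) (HahnSeries.ofPowerSeries ℤ k b /
          HahnSeries.ofPowerSeries ℤ k (derivative k (ψ X) * v)) : ↥φ.fieldRange) :
            LaurentSeries k) = φ (HahnSeries.ofPowerSeries ℤ k g) := by
  set ι := HahnSeries.ofPowerSeries ℤ k with hι
  have hinj : Function.Injective ι := HahnSeries.ofPowerSeries_injective
  have hX0 : ψ X ≠ 0 := by
    rw [hX]
    exact mul_ne_zero (pow_ne_zero _ X_ne_zero) (left_ne_zero_of_mul_eq_one hu)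
  let κ : LaurentSeries k →+* φ.fieldRange := φ.rangeRestrictField
  have hκ : ∀ y, (algebraMap φ.fieldRange (LaurentSeries k)) (κ y) = φ y := fun y => rfl
  have hκs : Function.Surjective κ := φ.rangeRestrictField_bijective.2
  have hφX : φ (ι X) ≠ 0 := by
    rw [hψ]; exact fun h => hX0 (hinj (by rw [h, map_zero]))
  -- linear independence
  have hli : LinearIndependent φ.fieldRange (fun i : Fin n => ι X ^ (i : ℕ)) := by
    rw [Fintype.linearIndependent_iff]
    intro c hc i
    choose ℓ hℓ using fun i => hκs (c i)
    choose N hN using fun i => aux_eqpow (ℓ i)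
    let M := ∑ i, N i
    choose b hb using fun i => hN i M (Finset.single_le_sum (fun _ _ => Nat.zero_le _) (Finset.mem_univ i))
    let g : ℕ → k⟦X⟧ := fun i => if h : i < n then b ⟨i, h⟩ else 0
    have hg : ∀ i : Fin n, g i = b i := fun i => by simp [g]
    have h1 : ∑ i ∈ Finset.range n, ψ (g i) * X ^ i = 0 := by
      apply hinj
      rw [map_zero, Finset.sum_range, map_sum]
      have : ∀ i : Fin n, ι (ψ (g i) * X ^ (i : ℕ)) = φ (ι X) ^ M * (c i • ι X ^ (i : ℕ)) := by
        intro i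
        rw [hg, map_mul, ← hψ, ← hb, map_mul, Algebra.smul_def, ← hℓ, hκ, map_pow, map_pow]
        ring
      rw [Finset.sum_congr rfl (fun i _ => this i), ← Finset.mul_sum, hc, mul_zero]
    have h2 := aux_indep ψ hC n u hX hX0 g h1 i i.2
    rw [hg] at h2
    have h3 := hb i
    rw [h2, map_zero] at h3
    have h4 : ι X ^ M ≠ 0 := pow_ne_zero _ fun h => X_ne_zero (hinj (by rw [h, map_zero]))
    rw [← hℓ, (mul_eq_zero.mp h3).resolve_right h4, map_zero]
  have hspanι : ∀ b : k⟦X⟧, ι b ∈ Submodule.span φ.fieldRange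
      (Set.range (fun i : Fin n => ι X ^ (i : ℕ))) := by
    intro b
    obtain ⟨g, hg⟩ := aux_exists ψ hC n hn u u' hu hX b
    rw [hg, map_sum]
    refine Submodule.sum_mem _ fun i hi => ?_
    rw [map_mul, ← hψ, ← hκ, ← Algebra.smul_def, map_pow]
    exact Submodule.smul_mem _ _ (Submodule.subset_span ⟨⟨i, Finset.mem_range.mp hi⟩, rfl⟩)
  have hspan : ⊤ ≤ Submodule.span φ.fieldRange
      (Set.range (fun i : Fin n => ι X ^ (i : ℕ))) := by
    intro y _
    obtain ⟨N, hN⟩ := aux_eqpow y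
    obtain ⟨b, hb⟩ := hN N le_rfl
    have h1 : φ (ι X) ^ N * y = ι ((X ^ (n - 1) * u) ^ N * b) := by
      rw [map_mul, ← hb, hψ, hX, ← map_pow, ← map_pow]
      rw [mul_comm y, ← mul_assoc, ← map_mul]
      congr 2
      rw [← mul_pow]
      congr 1
      rw [mul_right_comm, pow_sub_one_mul (by omega)]
    have h2 : y = κ ((ι X ^ N)⁻¹) • ι ((X ^ (n - 1) * u) ^ N * b) := by
      rw [← h1, Algebra.smul_def, hκ, map_inv₀, map_pow, inv_mul_cancel_left₀ (pow_ne_zero _ hφX)]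
    rw [h2]
    exact Submodule.smul_mem _ _ (hspanι _)
  let pb : PowerBasis φ.fieldRange (LaurentSeries k) :=
    { gen := ι X, dim := n, basis := Module.Basis.mk hli hspan, basis_eq_pow := by simp }
  obtain ⟨g, hg⟩ := aux_exists ψ hC n hn u u' hu hX (X ^ n)
  obtain ⟨v, huv, hv⟩ := aux_diff ψ hC n hn u hX g hg
  let f : Polynomial φ.fieldRange := Polynomial.X ^ n -
    ∑ i ∈ Finset.range n, Polynomial.C (κ (ι (g i))) * Polynomial.X ^ i
  have hdeg : (∑ i ∈ Finset.range n, Polynomial.C (κ (ι (g i))) * Polynomial.X ^ i).degree <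
      (n : WithBot ℕ) := by
    refine (Polynomial.degree_sum_le _ _).trans_lt ?_
    refine (Finset.sup_lt_iff (WithBot.bot_lt_coe n)).mpr ?_
    intro i hi
    refine (Polynomial.degree_C_mul_X_pow_le _ _).trans_lt ?_
    exact WithBot.coe_lt_coe.mpr (Finset.mem_range.mp hi)
  have hfm : f.Monic := Polynomial.monic_X_pow_sub hdeg
  have hfd : f.natDegree = n := by
    apply Polynomial.natDegree_eq_of_degree_eq_some
    rw [Polynomial.degree_sub_eq_left_of_degree_lt] <;> rw [Polynomial.degree_X_pow]
    exact hdeg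
  have hroot : Polynomial.aeval (ι X) f = 0 := by
    simp only [f, map_sub, map_pow, map_sum, map_mul, Polynomial.aeval_X, Polynomial.aeval_C, hκ, hψ]
    rw [← map_pow, hg]
    simp
  have hmin : minpoly φ.fieldRange (ι X) = f := by
    refine (Polynomial.eq_of_monic_of_dvd_of_natDegree_le (minpoly.monic pb.isIntegral_gen) hfm
      (minpoly.dvd _ _ hroot) ?_).symm
    rw [hfd]
    exact pb.natDegree_minpoly.ge
  have hder : Polynomial.aeval pb.gen (Polynomial.derivative (minpoly φ.fieldRange pb.gen)) =
      ι (derivative k (ψ X) * v) := by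
    change Polynomial.aeval (ι X) (Polynomial.derivative (minpoly φ.fieldRange (ι X))) = _
    rw [hmin, ← hv]
    simp only [f, Polynomial.derivative_sub, Polynomial.derivative_sum, Polynomial.derivative_X_pow,
      Polynomial.derivative_C_mul, map_sub, map_pow, map_sum, map_mul, Polynomial.aeval_X,
      Polynomial.aeval_C, hκ, hψ, map_natCast]
  have hne : ι (derivative k (ψ X) * v) ≠ 0 := by
    intro h
    have h1 : derivative k (ψ X) * v = 0 := hinj (by rw [h, map_zero])
    have hv0 : v ≠ 0 := by
      rintro rfl
      simp at huv
    exact (mul_ne_zero hd hv0) h1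
  refine ⟨v, huv, fun b => ?_⟩
  obtain ⟨c, hc⟩ := aux_exists ψ hC n hn u u' hu hX b
  refine ⟨c (n - 1), ?_, ?_⟩
  · rw [hc, aux_coeff ψ hC n u hX c (n - 1) (by omega)]
  · have h1 : ι b / ι (derivative k (ψ X) * v) = ∑ i ∈ Finset.range n,
        κ (ι (c i)) • (ι X ^ i / ι (derivative k (ψ X) * v)) := by
      rw [hc, map_sum, Finset.sum_div]
      refine Finset.sum_congr rfl fun i _ => ?_
      rw [Algebra.smul_def, hκ, hψ, map_mul, map_pow, mul_div_assoc]
    have h2 : ∀ i ∈ Finset.range n, Algebra.trace φ.fieldRange (LaurentSeries k)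
        (ι X ^ i / ι (derivative k (ψ X) * v)) = if i = n - 1 then 1 else 0 := by
      intro i hi
      have := aux_trace pb (by rw [hder]; exact hne) i (Finset.mem_range.mp hi)
      rw [hder] at this
      refine this.trans ?_
      change (if i + 1 = n then _ else _) = _
      split_ifs <;> first | rfl | omega
    rw [h1, map_sum]
    simp only [map_smul]
    rw [Finset.sum_congr rfl (fun i hi => by rw [h2 i hi])]
    simp [show n - 1 < n by omega]
    rfl

theorem aux_order_ne {k : Type*} [Field k] {y : LaurentSeries k} (h : y ≠ 0) :
    y.coeff y.order ≠ 0 :=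
  mt HahnSeries.coeff_order_eq_zero.mp h

theorem aux_of_ordGe {k : Type*} [Field k] (y : LaurentSeries k) (h : ordGe y 0) :
    ∃ b : k⟦X⟧, y = HahnSeries.ofPowerSeries ℤ k b := by
  rcases h with rfl | h
  · exact ⟨0, by simp⟩
  · refine ⟨X ^ y.order.toNat * y.powerSeriesPart, ?_⟩
    exact (LaurentSeries.X_order_mul_powerSeriesPart (by omega)).symm

theorem aux_ordGe_pow {k : Type*} [Field k] (m : ℕ) (M : ℤ) (hM : M ≤ m) (h : k⟦X⟧) :
    ordGe (HahnSeries.ofPowerSeries ℤ k (X ^ m * h)) M := by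
  by_cases h0 : HahnSeries.ofPowerSeries ℤ k (X ^ m * h) = 0
  · exact Or.inl h0
  · right
    by_contra hlt
    refine aux_order_ne h0 ?_
    rw [PowerSeries.coeff_coe]
    split_ifs with hneg
    · rfl
    · rw [coeff_X_pow_mul', if_neg (by omega)]

theorem aux_exists_psi {k : Type*} [Field k] (φ : LaurentSeries k →+* LaurentSeries k)
    (hφC : ∀ a : k, φ (HahnSeries.single 0 a) = HahnSeries.single 0 a)
    (x0 : k⟦X⟧) (hφX : φ tt = HahnSeries.ofPowerSeries ℤ k x0)
    (hφcont : ∀ N : ℤ, ∃ M : ℤ, ∀ y : LaurentSeries k, ordGe y M → ordGe (φ y) N) :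
    ∃ ψ : k⟦X⟧ →+* k⟦X⟧, (∀ g, φ (HahnSeries.ofPowerSeries ℤ k g) =
      HahnSeries.ofPowerSeries ℤ k (ψ g)) ∧ (∀ a : k, ψ (C a) = C a) ∧ ψ X = x0 := by
  set ι := HahnSeries.ofPowerSeries ℤ k with hι
  have hinj : Function.Injective ι := HahnSeries.ofPowerSeries_injective
  have hιC : ∀ a : k, φ (ι (C a)) = ι (C a) := by
    intro a
    rw [hι, HahnSeries.ofPowerSeries_C]
    exact hφC a
  have hιX : φ (ι X) = ι x0 := by
    rw [← hφX, hι, HahnSeries.ofPowerSeries_X]; rfl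
  have key : ∀ m : ℕ, (∀ h, ∃ b, φ (ι (X ^ m * h)) = ι b) → ∀ h, ∃ b, φ (ι h) = ι b := by
    intro m
    induction m with
    | zero => intro H h; simpa using H h
    | succ m ih =>
      intro H
      apply ih
      intro h
      obtain ⟨b, hb⟩ := H (mk fun p => coeff (p + 1) h)
      refine ⟨b + x0 ^ m * C (constantCoeff h), ?_⟩
      conv_lhs => rw [eq_X_mul_shift_add_const h]
      rw [mul_add, ← mul_assoc, ← pow_succ, map_add, map_add, hb, map_mul, map_mul, hιC, map_pow,
        map_pow, hιX, map_add, map_mul, map_pow]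
  obtain ⟨M, hM⟩ := hφcont 0
  have h1 := key M.toNat (fun h => aux_of_ordGe _ (hM _ (aux_ordGe_pow _ M (by omega) h)))
  choose f hf using h1
  refine ⟨{ toFun := f, map_one' := ?_, map_mul' := ?_, map_zero' := ?_, map_add' := ?_ }, ?_, ?_, ?_⟩
  · exact hinj (by rw [← hf]; simp)
  · intro a b; exact hinj (by rw [← hf]; simp [hf])
  · exact hinj (by rw [← hf]; simp)
  · intro a b; exact hinj (by rw [← hf]; simp [hf])
  · exact hf
  · intro a; exact hinj (by rw [← hιC a]; exact (hf _).symm)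
  · exact hinj (by rw [← hιX]; exact (hf _).symm)

theorem aux_lsDeriv {k : Type*} [Field k] (f : k⟦X⟧) :
    lsDeriv (HahnSeries.ofPowerSeries ℤ k f) = HahnSeries.ofPowerSeries ℤ k (derivative k f) := by
  ext j
  change (j + 1) • (HahnSeries.ofPowerSeries ℤ k f).coeff (j + 1) = _
  rw [PowerSeries.coeff_coe, PowerSeries.coeff_coe]
  by_cases h : j < 0
  · rw [if_pos h]
    by_cases h' : j + 1 < 0
    · rw [if_pos h', smul_zero]
    · rw [show j + 1 = 0 by omega, zero_smul]
  · rw [if_neg h, if_neg (by omega), coeff_derivative]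
    lift j to ℕ using (by omega)
    rw [show (((j : ℤ) + 1).natAbs) = j + 1 by omega, Int.natAbs_natCast, zsmul_eq_mul]
    push_cast
    ring

theorem aux_pid (k : Type*) [Field k] : IsPrincipalIdealRing (psRange k) :=
  IsPrincipalIdealRing.of_surjective (HahnSeries.ofPowerSeries ℤ k).rangeRestrict
    (HahnSeries.ofPowerSeries ℤ k).rangeRestrict_surjective

/-- Recover an ideal from its inverse. -/
theorem aux_ideal (k : Type*) [Field k]
    [IsFractionRing ↥(psRange k) (LaurentSeries k)] (D : Ideal ↥(psRange k))
    (d : LaurentSeries k) (hd : d ≠ 0)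
    (h : 1 / (D : FractionalIdeal (nonZeroDivisors ↥(psRange k)) (LaurentSeries k)) =
      spanSingleton (nonZeroDivisors ↥(psRange k)) d⁻¹) :
    (D : FractionalIdeal (nonZeroDivisors ↥(psRange k)) (LaurentSeries k)) =
      spanSingleton (nonZeroDivisors ↥(psRange k)) d := by
  have := aux_pid k
  obtain ⟨e, rfl⟩ := (IsPrincipalIdealRing.principal D).principal
  change ((Ideal.span {e} : Ideal (psRange k)) :
    FractionalIdeal (nonZeroDivisors ↥(psRange k)) (LaurentSeries k)) = _
  change 1 / ((Ideal.span {e} : Ideal (psRange k)) :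
    FractionalIdeal (nonZeroDivisors ↥(psRange k)) (LaurentSeries k)) = _ at h
  rw [coeIdeal_span_singleton] at h ⊢
  have h2 := congrArg (fun I => 1 / I) h
  simpa only [one_div_spanSingleton, inv_inv] using h2

end Helpers

/-- Let `k` be a perfect field of characteristic `p > 0`, `L = k((t))`,
`x ∈ k[[t]]` with `n = ord(x) ≥ 1` and `x' ≠ 0`, `φ` the continuous `k`-algebra
endomorphism of `k((t))` with `φ(X) = x`, `K = φ(k((X)))` with valuation ring
`A = φ(k[[X]])`, maximal ideal `m_K = x·A`, and let `D = D_{k[[t]]/A}` be the different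
(characterized by the trace-dual property). Then `δ = t·x'/x` is a refined logarithmic
different of `L` over `K`: `δ·k[[t]] = m_K⁻¹·m_L·D` as fractional ideals of `L` over
`k[[t]]` (with `m_L = t·k[[t]]`), and for every `a ∈ k[[t]]` one has
`Tr_{L/K}(δ⁻¹·a) ∈ A` and `Tr_{L/K}(δ⁻¹·a) − φ(a(0)) ∈ m_K`. -/
theorem statement16 (p : ℕ) (hp : p.Prime)
    (k : Type*) [Field k] [PerfectField k] [CharP k p]
    (x : LaurentSeries k) (hx : x ≠ 0)
    (n : ℕ) (hn1 : 1 ≤ n) (hxord : x.order = (n : ℤ))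
    (hx' : lsDeriv x ≠ 0)
    (φ : LaurentSeries k →+* LaurentSeries k)
    (hφC : ∀ a : k, φ (HahnSeries.single 0 a) = HahnSeries.single 0 a)
    (hφX : φ tt = x)
    (hφcont : ∀ N : ℤ, ∃ M : ℤ, ∀ y : LaurentSeries k, ordGe y M → ordGe (φ y) N)
    [IsFractionRing ↥(psRange k) (LaurentSeries k)]
    (D : Ideal ↥(psRange k))
    (hD : ∀ J : FractionalIdeal (nonZeroDivisors ↥(psRange k)) (LaurentSeries k),
      (∀ y ∈ J,
          ((Algebra.trace ↥φ.fieldRange (LaurentSeries k) y : ↥φ.fieldRange) :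
            LaurentSeries k) ∈ Subring.map φ (psRange k)) ↔
        J ≤ 1 / (D : FractionalIdeal (nonZeroDivisors ↥(psRange k)) (LaurentSeries k))) :
    spanSingleton (nonZeroDivisors ↥(psRange k)) (tt * lsDeriv x / x) =
      (1 / spanSingleton (nonZeroDivisors ↥(psRange k)) x) *
        spanSingleton (nonZeroDivisors ↥(psRange k)) (tt : LaurentSeries k) *
        (D : FractionalIdeal (nonZeroDivisors ↥(psRange k)) (LaurentSeries k)) ∧
    ∀ a : LaurentSeries k, a ∈ psRange k →
      ((Algebra.trace ↥φ.fieldRange (LaurentSeries k) ((tt * lsDeriv x / x)⁻¹ * a) :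
          ↥φ.fieldRange) : LaurentSeries k) ∈ Subring.map φ (psRange k) ∧
      ∃ z ∈ Subring.map φ (psRange k),
        ((Algebra.trace ↥φ.fieldRange (LaurentSeries k) ((tt * lsDeriv x / x)⁻¹ * a) :
            ↥φ.fieldRange) : LaurentSeries k) -
          φ (HahnSeries.single 0 (a.coeff 0)) = x * z := by
  set ι := HahnSeries.ofPowerSeries ℤ k with hι
  have hinj : Function.Injective ι := HahnSeries.ofPowerSeries_injective
  have hmem : ∀ b, ι b ∈ psRange k := fun b => ⟨b, rfl⟩
  have htt : (tt : LaurentSeries k) = ι PowerSeries.X := HahnSeries.ofPowerSeries_X.symm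
  have htt0 : (tt : LaurentSeries k) ≠ 0 := by
    rw [htt]; exact fun h => PowerSeries.X_ne_zero (hinj (by rw [h, map_zero]))
  set u := x.powerSeriesPart with hudef
  have hxu : x = ι (PowerSeries.X ^ n * u) :=
    (LaurentSeries.X_order_mul_powerSeriesPart hxord.symm).symm
  have hu0 : PowerSeries.constantCoeff u ≠ 0 := by
    rw [← PowerSeries.coeff_zero_eq_constantCoeff_apply, hudef, LaurentSeries.powerSeriesPart_coeff]
    simpa using aux_order_ne hx
  have hu : u * u⁻¹ = 1 := PowerSeries.mul_inv_cancel u hu0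
  obtain ⟨ψ, hψ, hψC, hψX⟩ := aux_exists_psi φ hφC (PowerSeries.X ^ n * u) (by rw [hφX, hxu]) hφcont
  set d := PowerSeries.derivative k (ψ PowerSeries.X) with hd
  have hxd : lsDeriv x = ι d := by
    rw [hd, hψX, hxu]; exact aux_lsDeriv _
  have hd0 : d ≠ 0 := by
    intro h
    exact hx' (by rw [hxd, h, map_zero])
  have hιd0 : ι d ≠ 0 := by rwa [hxd] at hx'
  obtain ⟨v, huv, hv⟩ := aux_field φ ψ hψ hψC n hn1 u u⁻¹ hu hψX hd0
  have hv0 : ι v ≠ 0 := by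
    intro h
    have : v = 0 := hinj (by rw [h, map_zero])
    rw [this] at huv
    simp at huv
  have T2 : ∀ b, ∃ g : PowerSeries k, ((Algebra.trace ↥φ.fieldRange (LaurentSeries k)
      (ι b / ι d) : ↥φ.fieldRange) : LaurentSeries k) = φ (ι g) := by
    intro b
    obtain ⟨g, -, hg⟩ := hv (v * b)
    refine ⟨g, ?_⟩
    rw [← hg]
    congr 2
    change _ = ι (v * b) / ι (d * v)
    rw [map_mul, map_mul]
    field_simp
  have T1 : ∀ a, ∃ g : PowerSeries k, PowerSeries.constantCoeff g = PowerSeries.constantCoeff a ∧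
      ((Algebra.trace ↥φ.fieldRange (LaurentSeries k)
      ((tt * lsDeriv x / x)⁻¹ * ι a) : ↥φ.fieldRange) : LaurentSeries k) = φ (ι g) := by
    intro a
    obtain ⟨g, hg0, hg⟩ := hv (PowerSeries.X ^ (n - 1) * (u * v * a))
    refine ⟨g, ?_, ?_⟩
    · rw [hg0, PowerSeries.coeff_X_pow_mul', if_pos le_rfl, Nat.sub_self,
        PowerSeries.coeff_zero_eq_constantCoeff_apply, map_mul, map_mul, huv, one_mul]
    · rw [← hg]
      congr 2
      change _ = ι (PowerSeries.X ^ (n - 1) * (u * v * a)) / ι (d * v)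
      have e : x = tt * ι (PowerSeries.X ^ (n - 1) * u) := by
        rw [htt, ← map_mul, ← mul_assoc, ← pow_succ', Nat.sub_add_cancel hn1, hxu]
      have e2 : ι (PowerSeries.X ^ (n - 1) * (u * v * a)) =
          ι (PowerSeries.X ^ (n - 1) * u) * ι v * ι a := by
        rw [← map_mul, ← map_mul]; congr 1; ring
      rw [hxd, inv_div, e2, map_mul ι d v]
      conv_lhs => rw [e]
      field_simp
  have hsmul : ∀ (r : psRange k) (y : LaurentSeries k), r • y = (r : LaurentSeries k) * y :=
    fun r y => rfl
  constructor
  · have hinv : 1 / (D : FractionalIdeal (nonZeroDivisors ↥(psRange k)) (LaurentSeries k)) =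
        spanSingleton (nonZeroDivisors ↥(psRange k)) (ι d)⁻¹ := by
      apply le_antisymm
      · intro y hy
        rw [mem_spanSingleton]
        have htr := (hD _).mpr le_rfl
        suffices hs : ∃ b, y * ι d = ι b by
          obtain ⟨b, hb⟩ := hs
          refine ⟨⟨ι b, hmem b⟩, ?_⟩
          rw [hsmul]
          change ι b * _ = _
          rw [← hb, mul_inv_cancel_right₀ hιd0]
        by_contra hcon
        have hne : y * ι d ≠ 0 := fun h => hcon ⟨0, by rw [h, map_zero]⟩
        have hneg : (y * ι d).order < 0 := by
          by_contra hge
          exact hcon (aux_of_ordGe _ (Or.inr (not_lt.mp hge)))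
        set w := y * ι d with hw
        have hw0 : PowerSeries.constantCoeff w.powerSeriesPart ≠ 0 := by
          rw [← PowerSeries.coeff_zero_eq_constantCoeff_apply, LaurentSeries.powerSeriesPart_coeff]
          simpa using aux_order_ne hne
        obtain ⟨m, hm⟩ : ∃ m : ℕ, w.order = -1 - (m : ℤ) := ⟨(-1 - w.order).toNat, by omega⟩
        let r := PowerSeries.X ^ m * w.powerSeriesPart⁻¹
        have hr : tt * (ι r * w) = 1 := by
          have h1 := w.single_order_mul_powerSeriesPart
          have h2 : ι w.powerSeriesPart⁻¹ * ι w.powerSeriesPart = 1 := by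
            rw [← map_mul, PowerSeries.inv_mul_cancel _ hw0, map_one]
          have h3 : (tt : LaurentSeries k) * ι (PowerSeries.X ^ m) * HahnSeries.single w.order 1 = 1 := by
            rw [hι, HahnSeries.ofPowerSeries_X_pow, tt, HahnSeries.single_mul_single,
              HahnSeries.single_mul_single, hm]
            simp
          conv_lhs => rw [← h1]
          simp only [r, map_mul]
          linear_combination (ι w.powerSeriesPart⁻¹ * ι w.powerSeriesPart) * h3 + h2
        have hry : ι r * y ∈ 1 / (D : FractionalIdeal (nonZeroDivisors ↥(psRange k)) (LaurentSeries k)) := by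
          have := Submodule.smul_mem (1 / (D : FractionalIdeal (nonZeroDivisors ↥(psRange k))
            (LaurentSeries k)) : FractionalIdeal (nonZeroDivisors ↥(psRange k))
            (LaurentSeries k)).coeToSubmodule (⟨ι r, hmem r⟩ : psRange k) hy
          exact this
        obtain ⟨_, ⟨g, rfl⟩, hg⟩ := htr _ hry
        obtain ⟨g1, hg10, hg1⟩ := T1 1
        have e : (tt * lsDeriv x / x)⁻¹ * ι 1 =
            (φ.rangeRestrictField tt : φ.fieldRange) • (ι r * y) := by
          rw [Algebra.smul_def]
          change _ = φ tt * (ι r * y)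
          rw [hφX, hxd, map_one, mul_one, inv_div, div_eq_iff (mul_ne_zero htt0 hιd0)]
          rw [hw] at hr
          linear_combination (-x) * hr
        rw [e, map_smul] at hg1
        have hg2 : φ (ι (PowerSeries.X * g)) = φ (ι g1) := by
          rw [← hg1]
          rw [Algebra.smul_def]
          rw [map_mul, ← htt, map_mul]
          change φ tt * φ (ι g) = φ tt * _
          rw [← hg]
        have hg3 := hinj (φ.injective hg2)
        rw [← hg3] at hg10
        simp at hg10
      · rw [← hD]
        intro y hy
        rw [mem_spanSingleton] at hy
        obtain ⟨⟨_, b, rfl⟩, rfl⟩ := hy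
        obtain ⟨g, hg⟩ := T2 b
        refine ⟨ι g, hmem g, ?_⟩
        rw [← hg, hsmul, div_eq_mul_inv]
    rw [aux_ideal k D (ι d) hιd0 hinv, one_div_spanSingleton, spanSingleton_mul_spanSingleton,
      spanSingleton_mul_spanSingleton, hxd]
    congr 1
    rw [div_eq_mul_inv]; ring
  · rintro _ ⟨a, rfl⟩
    obtain ⟨g, hg0, hg⟩ := T1 a
    change ((Algebra.trace ↥φ.fieldRange (LaurentSeries k)
      ((tt * lsDeriv x / x)⁻¹ * ι a) : ↥φ.fieldRange) : LaurentSeries k) ∈ _ ∧ ∃ z ∈ _,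
      ((Algebra.trace ↥φ.fieldRange (LaurentSeries k)
      ((tt * lsDeriv x / x)⁻¹ * ι a) : ↥φ.fieldRange) : LaurentSeries k) - _ = _
    rw [hg]
    refine ⟨⟨ι g, hmem g, rfl⟩, φ (ι (PowerSeries.mk fun q => PowerSeries.coeff (q + 1) g)),
      ⟨_, hmem _, rfl⟩, ?_⟩
    have hc : (HahnSeries.single 0 ((ι a).coeff 0) : LaurentSeries k) =
        ι (PowerSeries.C (PowerSeries.constantCoeff g)) := by
      rw [hg0, hι, HahnSeries.ofPowerSeries_C, PowerSeries.coeff_coe]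
      simp [HahnSeries.C_apply]
    change _ - φ (HahnSeries.single 0 ((ι a).coeff 0)) = _
    rw [hc, ← hφX, htt, ← map_mul, ← map_mul, ← map_sub, ← map_sub,
      PowerSeries.sub_const_eq_X_mul_shift]


end LFT
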